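/- For every real c > 0 there exists a constant C = C(c) > 0 such that for all integers 2 ≤ k ≤ n with n ≥ 2, there exists a (1 + c^{−k})-balanced (n,k,2)-splitter of size at most 2^{C·k}·log n. -/

import Mathlib

open Finset

attribute [local instance] Classical.propDecidable

/-- The number of functions in the family `F` that are injective on the set `S`. -/
noncomputable def injCount {n l N : ℕ} (F : Fin N → Fin n → Fin l) (S : Finset (Fin n)) : ℕ :=
  (Finset.univ.filter fun i => Set.InjOn (F i) ↑S).card

/-- `split(S)`: if `k ≤ l` this counts the functions injective on `S`; if `k > l` it counts
the functions whose first `k mod l` color classes within `S` have size `⌈k/l⌉` and whose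
remaining color classes within `S` have size `⌊k/l⌋`. -/
noncomputable def splitCount {n l N : ℕ} (k : ℕ) (F : Fin N → Fin n → Fin l)
    (S : Finset (Fin n)) : ℕ :=
  if k ≤ l then injCount F S
  else (Finset.univ.filter fun i : Fin N => ∀ j : Fin l,
    (S.filter fun x => F i x = j).card =
      (if (j : ℕ) < k % l then (k + l - 1) / l else k / l)).card

/-- `F` is a `δ`-balanced `(n,k,l)`-splitter. -/
noncomputable def IsBalancedSplitter {n l N : ℕ} (k : ℕ) (δ : ℝ)
    (F : Fin N → Fin n → Fin l) : Prop :=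
  ∃ T : ℝ, 0 < T ∧ ∀ S : Finset (Fin n), S.card = k →
    T / δ ≤ (splitCount k F S : ℝ) ∧ (splitCount k F S : ℝ) ≤ δ * T

/-- A weak Hoeffding lemma: the moment generating function of a centred variable bounded by `1`
on a finite uniform space. -/
theorem sum_exp_mul_le {Ω : Type*} [Fintype Ω] (Y : Ω → ℝ) (hY : ∀ ω, |Y ω| ≤ 1)
    (hmean : ∑ ω, Y ω = 0) (a : ℝ) (ha : |a| ≤ 1) :
    ∑ ω, Real.exp (a * Y ω) ≤ Fintype.card Ω * Real.exp (a ^ 2) := by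
  have hpt : ∀ ω, Real.exp (a * Y ω) ≤ 1 + a * Y ω + a ^ 2 := by
    intro ω
    have h1 : |a * Y ω| ≤ 1 := by
      rw [abs_mul]
      exact mul_le_one₀ ha (abs_nonneg _) (hY ω)
    have h2 := le_of_abs_le (Real.abs_exp_sub_one_sub_id_le h1)
    have h3 : (Y ω) ^ 2 ≤ 1 := (sq_le_one_iff_abs_le_one _).2 (hY ω)
    nlinarith [mul_le_mul_of_nonneg_left h3 (sq_nonneg a)]
  calc ∑ ω, Real.exp (a * Y ω) ≤ ∑ ω, (1 + a * Y ω + a ^ 2) := sum_le_sum fun ω _ => hpt ω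
    _ = Fintype.card Ω * (a ^ 2 + 1) := by
        simp only [sum_add_distrib, ← mul_sum, hmean, sum_const, card_univ, nsmul_eq_mul]
        ring
    _ ≤ _ := by
        gcongr
        exact Real.add_one_le_exp _

theorem sum_exp_mul_sum_le {Ω : Type*} [Fintype Ω] (Y : Ω → ℝ) (hY : ∀ ω, |Y ω| ≤ 1)
    (hmean : ∑ ω, Y ω = 0) (a : ℝ) (ha : |a| ≤ 1) (N : ℕ) :
    ∑ F : Fin N → Ω, Real.exp (a * ∑ i, Y (F i)) ≤
      (Fintype.card Ω : ℝ) ^ N * Real.exp (a ^ 2 * N) := by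
  calc ∑ F : Fin N → Ω, Real.exp (a * ∑ i, Y (F i))
      = ∑ F : Fin N → Ω, ∏ i, Real.exp (a * Y (F i)) := by
        simp only [mul_sum, Real.exp_sum]
    _ = (∑ ω, Real.exp (a * Y ω)) ^ N := (Fintype.sum_pow (fun ω => Real.exp (a * Y ω)) N).symm
    _ ≤ (Fintype.card Ω * Real.exp (a ^ 2)) ^ N := by
        gcongr
        exact sum_exp_mul_le Y hY hmean a ha
    _ = _ := by rw [mul_pow, ← Real.exp_nat_mul, mul_comm (N : ℝ)]

/-- Simultaneous sampling: if `N` is logarithmically large in the number of test variables, some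
sample of size `N` has all its empirical sums within `t * N` of zero. -/
theorem exists_sample_abs_sum_le {Ω ι : Type*} [Fintype Ω] [Nonempty Ω] (s : Finset ι)
    (Y : ι → Ω → ℝ) (hY : ∀ x ∈ s, ∀ ω, |Y x ω| ≤ 1) (hmean : ∀ x ∈ s, ∑ ω, Y x ω = 0)
    {t K : ℝ} (ht : 0 < t) (ht1 : t ≤ 1) (hK : 0 < K) (hs : (#s : ℝ) ≤ K) (N : ℕ)
    (hN : Real.log (2 * K) ≤ t ^ 2 / 4 * N) :
    ∃ F : Fin N → Ω, ∀ x ∈ s, |∑ i, Y x (F i)| ≤ t * N := by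
  set a := t / 2 with ha
  have ha1 : |a| ≤ 1 := by rw [abs_of_pos (by positivity)]; linarith
  have ha2 : |-a| ≤ 1 := by rwa [abs_neg]
  set G : (Fin N → Ω) → ℝ := fun F =>
    ∑ x ∈ s, (Real.exp (a * ∑ i, Y x (F i)) + Real.exp (-a * ∑ i, Y x (F i))) with hG
  have htot : ∑ F, G F ≤ ∑ _F : Fin N → Ω, 2 * K * Real.exp (a ^ 2 * N) := by
    rw [hG, sum_comm]
    calc _ ≤ ∑ x ∈ s, 2 * ((Fintype.card Ω : ℝ) ^ N * Real.exp (a ^ 2 * N)) := by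
          refine sum_le_sum fun x hx => ?_
          rw [sum_add_distrib, two_mul]
          refine add_le_add (sum_exp_mul_sum_le _ (hY x hx) (hmean x hx) a ha1 N) ?_
          simpa using sum_exp_mul_sum_le _ (hY x hx) (hmean x hx) (-a) ha2 N
      _ ≤ K * (2 * ((Fintype.card Ω : ℝ) ^ N * Real.exp (a ^ 2 * N))) := by
          rw [sum_const, nsmul_eq_mul]
          gcongr
      _ = _ := by
          simp only [sum_const, card_univ, Fintype.card_fun, Fintype.card_fin, nsmul_eq_mul,
            Nat.cast_pow]
          ring
  obtain ⟨F, -, hF⟩ := exists_le_of_sum_le univ_nonempty htot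
  refine ⟨F, fun x hx => ?_⟩
  have hx2 := (single_le_sum (f := fun x => Real.exp (a * ∑ i, Y x (F i)) +
    Real.exp (-a * ∑ i, Y x (F i))) (fun _ _ => by positivity) hx).trans hF
  have key : ∀ z : ℝ, Real.exp (a * z) ≤ 2 * K * Real.exp (a ^ 2 * N) → z ≤ t * N := by
    intro z hz
    rw [← Real.exp_log (show 0 < 2 * K by positivity), ← Real.exp_add, Real.exp_le_exp] at hz
    have : a * z ≤ a * (t * N) := by
      rw [ha] at hz ⊢
      nlinarith
    exact le_of_mul_le_mul_left this (by positivity)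
  refine abs_le.2 ⟨?_, key _ (by linarith [Real.exp_pos (-a * ∑ i, Y x (F i))])⟩
  have := key (-∑ i, Y x (F i)) (by
    rw [mul_neg, ← neg_mul]
    linarith [Real.exp_pos (a * ∑ i, Y x (F i))])
  linarith

/-- The event that the single function `f` splits `S`. -/
def Splits {n l : ℕ} (k : ℕ) (f : Fin n → Fin l) (S : Finset (Fin n)) : Prop :=
  if k ≤ l then Set.InjOn f ↑S
  else ∀ j : Fin l, (S.filter fun x => f x = j).card =
    (if (j : ℕ) < k % l then (k + l - 1) / l else k / l)

theorem splitCount_eq_card_splits {n l N : ℕ} (k : ℕ) (F : Fin N → Fin n → Fin l)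
    (S : Finset (Fin n)) : splitCount k F S = #{i | Splits k (F i) S} := by
  unfold splitCount injCount Splits
  split_ifs <;> rfl

theorem splits_comp_perm_iff {n l k : ℕ} (f : Fin n → Fin l) (σ : Equiv.Perm (Fin n))
    (S : Finset (Fin n)) :
    Splits k (f ∘ σ) S ↔ Splits k f (S.map σ.toEmbedding) := by
  unfold Splits
  split_ifs with h
  · rw [coe_map]
    exact ⟨fun hf => hf.image_of_comp, fun hf => hf.comp σ.injective.injOn (Set.mapsTo_image _ _)⟩
  · simp only [filter_map, card_map]
    rfl

theorem Splits.congr {n l k : ℕ} {f g : Fin n → Fin l} {S : Finset (Fin n)}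
    (hg : Splits k g S) (h : ∀ x ∈ S, f x = g x) : Splits k f S := by
  unfold Splits at *
  split_ifs at * with hk
  · exact hg.congr fun x hx => (h x hx).symm
  · intro j
    rw [← hg j]
    congr 1
    exact filter_congr fun x hx => by rw [h x hx]

theorem card_splits_eq {n l k : ℕ} {S S' : Finset (Fin n)} (h : #S = #S') :
    #{f : Fin n → Fin l | Splits k f S} = #{f : Fin n → Fin l | Splits k f S'} := by
  obtain ⟨σ, hσ⟩ : ∃ σ : Equiv.Perm (Fin n), S.map σ.toEmbedding = S' := by
    let e : {x // x ∈ S} ≃ {x // x ∈ S'} := equivOfCardEq h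
    refine ⟨e.extendSubtype, eq_of_subset_of_card_le ?_ (by rw [card_map, h])⟩
    intro y hy
    obtain ⟨x, hx, rfl⟩ := mem_map.1 hy
    exact e.extendSubtype_mem x hx
  symm
  refine card_bij (fun f _ => f ∘ σ) ?_ ?_ ?_
  · intro f hf
    simpa [splits_comp_perm_iff, hσ] using hf
  · intro f _ g _ hfg
    exact σ.surjective.injective_comp_right hfg
  · intro f hf
    refine ⟨f ∘ σ.symm, ?_, by ext; simp⟩
    rw [mem_filter] at hf ⊢
    refine ⟨mem_univ _, ?_⟩
    rw [← hσ, ← splits_comp_perm_iff]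
    simpa [Function.comp_assoc] using hf.2

theorem exists_splits {n k : ℕ} (hk : 2 ≤ k) {S : Finset (Fin n)} (hS : #S = k) :
    ∃ g : Fin n → Fin 2, Splits k g S := by
  obtain ⟨A, hAS, hA⟩ := exists_subset_card_eq (show (k + 1) / 2 ≤ #S by omega)
  have h0 : #{x ∈ S | (if x ∈ A then (0 : Fin 2) else 1) = 0} = (k + 1) / 2 := by
    rw [← hA]
    congr 1
    ext x
    by_cases hx : x ∈ A
    · simp [hx, hAS hx]
    · simp [hx]
  have h1 : #{x ∈ S | (if x ∈ A then (0 : Fin 2) else 1) = 1} = k / 2 := by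
    have : {x ∈ S | (if x ∈ A then (0 : Fin 2) else 1) = 1} = S \ A := by
      ext x
      by_cases hx : x ∈ A <;> simp [hx]
    rw [this, card_sdiff_of_subset hAS]
    omega
  refine ⟨fun x => if x ∈ A then 0 else 1, ?_⟩
  unfold Splits
  split_ifs with h
  · obtain rfl : k = 2 := by omega
    intro x hx y hy hxy
    have hone : ∀ j : Fin 2, #{x ∈ S | (if x ∈ A then (0 : Fin 2) else 1) = j} ≤ 1 :=
      Fin.forall_fin_two.2 ⟨h0.le, h1.le⟩
    exact card_le_one.1 (hone (if y ∈ A then 0 else 1)) x (mem_filter.2 ⟨hx, hxy⟩) y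
      (mem_filter.2 ⟨hy, rfl⟩)
  · refine Fin.forall_fin_two.2 ⟨?_, ?_⟩
    · rw [h0]
      simp only [Fin.val_zero]
      split_ifs <;> omega
    · rw [h1]
      simp only [Fin.val_one]
      split_ifs <;> omega

theorem two_pow_le_two_pow_mul_card_splits {n k : ℕ} (hk : 2 ≤ k) {S : Finset (Fin n)}
    (hS : #S = k) : 2 ^ n ≤ 2 ^ k * #{f : Fin n → Fin 2 | Splits k f S} := by
  obtain ⟨g, hg⟩ := exists_splits hk hS
  have hkn : k ≤ n := by simpa [hS] using card_le_univ S
  have hsub : Fintype.piFinset (fun x => if x ∈ S then {g x} else univ) ⊆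
      ({f : Fin n → Fin 2 | Splits k f S} : Finset _) := by
    intro f hf
    rw [Fintype.mem_piFinset] at hf
    refine mem_filter.2 ⟨mem_univ _, hg.congr fun x hx => ?_⟩
    simpa [hx] using hf x
  have hcard : #(Fintype.piFinset (fun x => if x ∈ S then {g x} else univ)) = 2 ^ (n - k) := by
    rw [Fintype.card_piFinset]
    simp only [apply_ite card, card_singleton, card_univ, Fintype.card_fin, prod_ite, prod_const,
      one_pow, one_mul]
    congr 1
    rw [filter_not, filter_mem_eq_inter, univ_inter, ← compl_eq_univ_sdiff, card_compl, hS,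
      Fintype.card_fin]
  calc 2 ^ n = 2 ^ k * 2 ^ (n - k) := by rw [← pow_add]; congr 1; omega
    _ ≤ _ := Nat.mul_le_mul_left _ (hcard ▸ card_le_card hsub)

/-- For `2 ≤ k ≤ n` a random function splits every `k`-set with one and the same
probability, which is at least `2⁻ᵏ`. -/
theorem exists_split_probability {n k : ℕ} (hk : 2 ≤ k) (hkn : k ≤ n) :
    ∃ p : ℝ, ((2 : ℝ) ^ k)⁻¹ ≤ p ∧ p ≤ 1 ∧ ∀ S : Finset (Fin n), #S = k →
      (#{f : Fin n → Fin 2 | Splits k f S} : ℝ) = p * Fintype.card (Fin n → Fin 2) := by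
  obtain ⟨S₀, -, hS₀⟩ := exists_subset_card_eq
    (show k ≤ #(univ : Finset (Fin n)) by simpa using hkn)
  have hcard : (Fintype.card (Fin n → Fin 2) : ℝ) = 2 ^ n := by simp
  refine ⟨#{f : Fin n → Fin 2 | Splits k f S₀} / Fintype.card (Fin n → Fin 2), ?_, ?_, ?_⟩
  · have h : (2 : ℝ) ^ n ≤ 2 ^ k * #{f : Fin n → Fin 2 | Splits k f S₀} := by
      exact_mod_cast two_pow_le_two_pow_mul_card_splits hk hS₀
    rw [hcard, le_div_iff₀ (by positivity), inv_mul_le_iff₀ (by positivity)]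
    exact h
  · exact div_le_one_of_le₀ (by exact_mod_cast card_le_univ _) (by positivity)
  · intro S hS
    rw [card_splits_eq (hS.trans hS₀.symm), hcard, div_mul_cancel₀ _ (by positivity)]

/-- Logarithmically many samples approximate the splitting probability on all `k`-sets. -/
theorem exists_family_abs_splitCount_sub_le {n k : ℕ} (hn : 2 ≤ n) {p t : ℝ} (hp0 : 0 ≤ p)
    (hp1 : p ≤ 1)
    (hp : ∀ S : Finset (Fin n), #S = k →
      (#{f : Fin n → Fin 2 | Splits k f S} : ℝ) = p * Fintype.card (Fin n → Fin 2))
    (ht : 0 < t) (ht1 : t ≤ 1) (N : ℕ) (hN : (k + 1) * Real.logb 2 n ≤ t ^ 2 / 4 * N) :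
    ∃ F : Fin N → Fin n → Fin 2, ∀ S : Finset (Fin n), #S = k →
      |(splitCount k F S : ℝ) - p * N| ≤ t * N := by
  have hn' : (2 : ℝ) ≤ n := by exact_mod_cast hn
  have hlog : Real.log (2 * (n : ℝ) ^ k) ≤ t ^ 2 / 4 * N := by
    refine le_trans ?_ hN
    have h0 : 0 ≤ Real.log n := Real.log_nonneg (by linarith)
    calc Real.log (2 * (n : ℝ) ^ k) ≤ Real.log ((n : ℝ) ^ (k + 1)) := by
          refine Real.log_le_log (by positivity) ?_
          rw [pow_succ']
          gcongr
      _ = (k + 1) * Real.log n := by rw [Real.log_pow]; push_cast; rfl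
      _ ≤ (k + 1) * Real.logb 2 n := by
          gcongr
          rw [Real.logb, le_div_iff₀ (Real.log_pos (by norm_num))]
          nlinarith [Real.log_two_lt_d9]
  obtain ⟨F, hF⟩ := exists_sample_abs_sum_le (powersetCard k (univ : Finset (Fin n)))
    (fun S (f : Fin n → Fin 2) => (if Splits k f S then (1 : ℝ) else 0) - p)
    (fun S _ f => by
      split_ifs <;> rw [abs_le] <;> constructor <;> linarith)
    (fun S hS => by
      rw [sum_sub_distrib, sum_boole, hp S (mem_powersetCard.1 hS).2]
      simp [mul_comm])
    ht ht1 (K := (n : ℝ) ^ k) (by positivity)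
    (by
      rw [card_powersetCard, card_univ, Fintype.card_fin]
      exact_mod_cast Nat.choose_le_pow n k) N hlog
  refine ⟨F, fun S hS => ?_⟩
  have h := hF S (mem_powersetCard.2 ⟨subset_univ _, hS⟩)
  rw [sum_sub_distrib, sum_boole, ← splitCount_eq_card_splits] at h
  simpa [mul_comm] using h

theorem isBalancedSplitter_of_abs_sub_le {n l N k : ℕ} {F : Fin N → Fin n → Fin l} {T e ε : ℝ}
    (hT : 0 < T) (he0 : 0 ≤ e) (he1 : e ≤ 1) (heε : e ≤ ε)
    (h : ∀ S : Finset (Fin n), #S = k → |(splitCount k F S : ℝ) - T| ≤ e / 2 * T) :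
    IsBalancedSplitter k (1 + ε) F := by
  refine ⟨T, hT, fun S hS => ?_⟩
  obtain ⟨h1, h2⟩ := abs_le.1 (h S hS)
  constructor
  · rw [div_le_iff₀ (by linarith)]
    have h3 : (1 - e / 2) * T ≤ splitCount k F S := by linarith
    have h4 : 1 ≤ (1 - e / 2) * (1 + ε) := by nlinarith
    nlinarith [mul_le_mul_of_nonneg_right h3 (show 0 ≤ 1 + ε by linarith)]
  · nlinarith

theorem floor_sample_size_le {M L : ℝ} (hM : 1 ≤ M) (hL : 1 ≤ L) (k : ℕ) (hk : 2 ≤ k) :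
    16 * (k + 1) * ((2 * M) ^ k) ^ 2 * L + 1 ≤
      2 ^ ((2 * Real.logb 2 (2 * M) + 6) * (k : ℝ)) * L := by
  have hexp : (2 : ℝ) ^ ((2 * Real.logb 2 (2 * M) + 6) * (k : ℝ)) =
      ((2 * M) ^ k) ^ 2 * (2 ^ k) ^ 6 := by
    rw [add_mul, Real.rpow_add (by norm_num),
      show 2 * Real.logb 2 (2 * M) * (k : ℝ) = Real.logb 2 (2 * M) * ((k * 2 : ℕ) : ℝ) by
        push_cast; ring,
      Real.rpow_mul (by norm_num), Real.rpow_logb (by norm_num) (by norm_num) (by positivity),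
      Real.rpow_natCast, pow_mul,
      show (6 : ℝ) * k = ((k * 6 : ℕ) : ℝ) by push_cast; ring, Real.rpow_natCast, pow_mul]
  rw [hexp]
  have hkk : (k : ℝ) + 1 ≤ 2 ^ k := by exact_mod_cast Nat.lt_two_pow_self (n := k)
  have h4 : (4 : ℝ) ≤ 2 ^ k := by
    calc (4 : ℝ) = 2 ^ 2 := by norm_num
      _ ≤ 2 ^ k := pow_le_pow_right₀ (by norm_num) hk
  have hP : (1 : ℝ) ≤ ((2 * M) ^ k) ^ 2 := one_le_pow₀ (one_le_pow₀ (by linarith))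
  have hb : 16 * ((k : ℝ) + 1) + 1 ≤ (2 ^ k) ^ 6 := by
    set y : ℝ := 2 ^ k
    have : (4 : ℝ) ^ 5 * y ≤ y ^ 5 * y :=
      mul_le_mul_of_nonneg_right (pow_le_pow_left₀ (by norm_num) h4 5) (by linarith)
    nlinarith
  have hPL : 1 ≤ ((2 * M) ^ k) ^ 2 * L := one_le_mul_of_one_le_of_one_le hP hL
  nlinarith [mul_le_mul_of_nonneg_left hb (zero_le_one.trans hPL)]

/-- for every real `c > 0` there is a constant `C = C(c) > 0` such that for all
`2 ≤ k ≤ n` with `n ≥ 2` there exists a `(1 + c^{−k})`-balanced `(n,k,2)`-splitter of size at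
most `2^{C·k}·log₂ n`. -/
theorem stmt8 (c : ℝ) (hc : 0 < c) :
    ∃ C : ℝ, 0 < C ∧ ∀ n k : ℕ, 2 ≤ k → k ≤ n → 2 ≤ n →
      ∃ (N : ℕ) (F : Fin N → Fin n → Fin 2),
        IsBalancedSplitter k (1 + c ^ (-(k : ℝ))) F ∧
        (N : ℝ) ≤ 2 ^ (C * (k : ℝ)) * Real.logb 2 n := by
  have hM : 1 ≤ max 1 c := le_max_left _ _
  set M := max 1 c
  have hlogM : 0 ≤ Real.logb 2 (2 * M) := Real.logb_nonneg (by norm_num) (by linarith)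
  refine ⟨2 * Real.logb 2 (2 * M) + 6, by linarith, fun n k hk hkn hn => ?_⟩
  obtain ⟨p, hp_lower, hp1, hp⟩ := exists_split_probability hk hkn
  have hp0 : 0 < p := lt_of_lt_of_le (by positivity) hp_lower
  have hL : 1 ≤ Real.logb 2 n := by
    rw [Real.le_logb_iff_rpow_le (by norm_num) (by positivity), Real.rpow_one]
    exact_mod_cast hn
  set L := Real.logb 2 n
  set e : ℝ := (M ^ k)⁻¹ with he
  have he0 : 0 < e := by positivity
  have he1 : e ≤ 1 := inv_le_one_of_one_le₀ (one_le_pow₀ hM)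
  have heε : e ≤ c ^ (-(k : ℝ)) := by
    rw [Real.rpow_neg hc.le, Real.rpow_natCast, he]
    gcongr
    exact le_max_right _ _
  set t := e / 2 * p with ht
  have ht0 : 0 < t := by positivity
  have ht1 : t ≤ 1 := mul_le_one₀ (by linarith) hp0.le hp1
  have htinv : (t ^ 2)⁻¹ ≤ 4 * ((2 * M) ^ k) ^ 2 := by
    have hlow : (2 * (2 * M) ^ k)⁻¹ ≤ t := by
      calc (2 * (2 * M) ^ k)⁻¹ = e / 2 * (2 ^ k)⁻¹ := by
            rw [he, mul_pow]
            field_simp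
        _ ≤ t := mul_le_mul_of_nonneg_left hp_lower (by positivity)
    calc (t ^ 2)⁻¹ ≤ ((2 * (2 * M) ^ k)⁻¹ ^ 2)⁻¹ := by gcongr
      _ = _ := by rw [inv_pow, inv_inv]; ring
  set x := 4 * ((k + 1) * L) * (t ^ 2)⁻¹ with hx
  have hx0 : 0 ≤ x := by positivity
  have hxN : x ≤ (⌊x⌋₊ + 1 : ℕ) := by
    push_cast
    exact (Nat.lt_floor_add_one x).le
  have hN : (k + 1) * L ≤ t ^ 2 / 4 * (⌊x⌋₊ + 1 : ℕ) := by
    calc (k + 1) * L = t ^ 2 / 4 * x := by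
          rw [hx]
          field_simp
      _ ≤ _ := by gcongr
  obtain ⟨F, hF⟩ := exists_family_abs_splitCount_sub_le hn hp0.le hp1 hp ht0 ht1 _ hN
  refine ⟨⌊x⌋₊ + 1, F, isBalancedSplitter_of_abs_sub_le (T := p * (⌊x⌋₊ + 1 : ℕ))
    (by positivity) he0.le he1 heε fun S hS => ?_, ?_⟩
  · rw [← mul_assoc]
    exact hF S hS
  · refine le_trans ?_ (floor_sample_size_le hM hL k hk)
    push_cast
    gcongr
    calc (⌊x⌋₊ : ℝ) ≤ x := Nat.floor_le hx0
      _ ≤ 4 * ((k + 1) * L) * (4 * ((2 * M) ^ k) ^ 2) := by rw [hx]; gcongr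
      _ = _ := by ring
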